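/- arXiv:1405.1298 — 4 statements merged into one kernel-verified Lean document; each statement's English description precedes it below -/
import Mathlib

section
/- (Lagrangian sufficiency underlying Theorem 2.) Let λ̄ ∈ ℝ^m, μ̄ ∈ ℝ^N and Ȳ ∈ ℝ^N satisfy: A_r(λ̄,μ̄) is positive definite, A_r(λ̄,μ̄) Ȳ = b_r(λ̄,μ̄), E_r Ȳ = e, and Ȳ ∘ Ȳ = Ȳ. Then Ȳ is a global solution of the constrained problem: for every Y ∈ ℝ^N with E_r Y = e and Y ∘ Y = Y one has f(Ȳ) ≤ f(Y). -/
open Matrix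

/-- A stationary point of a convex quadratic `Y ↦ (1/2) Yᵀ M Y - cᵀ Y` is a global minimizer. -/
theorem quadratic_le_of_posSemidef {n : Type*} [Fintype n] {M : Matrix n n ℝ}
    (hM : M.PosSemidef) {c x : n → ℝ} (hx : M *ᵥ x = c) (y : n → ℝ) :
    (1/2) * (x ⬝ᵥ (M *ᵥ x)) - c ⬝ᵥ x ≤ (1/2) * (y ⬝ᵥ (M *ᵥ y)) - c ⬝ᵥ y := by
  have hsymm : Mᵀ = M := by simpa using hM.isHermitian.eq
  have hnonneg : 0 ≤ (y - x) ⬝ᵥ (M *ᵥ (y - x)) := by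
    simpa using hM.dotProduct_mulVec_nonneg (y - x)
  have hcross : x ⬝ᵥ (M *ᵥ y) = c ⬝ᵥ y := by
    rw [dotProduct_mulVec, ← mulVec_transpose, hsymm, hx]
  rw [mulVec_sub, hx, dotProduct_sub, sub_dotProduct, sub_dotProduct, hcross,
    dotProduct_comm y c, dotProduct_comm x c] at hnonneg
  rw [hx, dotProduct_comm x c]
  linarith

/-- On binary vectors, the quadratic objective equals the Lagrangian up to the term `λᵀ E Y`. -/
theorem quadratic_eq_lagrangian_of_mul_self {n k : Type*} [Fintype n] [DecidableEq n] [Fintype k]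
    (A : Matrix n n ℝ) (b : n → ℝ) (E : Matrix k n ℝ) (lam : k → ℝ) (mu : n → ℝ)
    {Y : n → ℝ} (hY : Y * Y = Y) :
    (1/2) * (Y ⬝ᵥ (A *ᵥ Y)) - b ⬝ᵥ Y =
      (1/2) * (Y ⬝ᵥ ((A + diagonal mu) *ᵥ Y)) - (b + (1/2 : ℝ) • mu - Eᵀ *ᵥ lam) ⬝ᵥ Y -
        lam ⬝ᵥ (E *ᵥ Y) := by
  have hdiag : Y ⬝ᵥ (diagonal mu *ᵥ Y) = mu ⬝ᵥ Y := by
    refine Finset.sum_congr rfl fun i _ => ?_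
    have hi : Y i * Y i = Y i := congrFun hY i
    rw [mulVec_diagonal]
    linear_combination mu i * hi
  have hE : (Eᵀ *ᵥ lam) ⬝ᵥ Y = lam ⬝ᵥ (E *ᵥ Y) := by
    rw [mulVec_transpose, dotProduct_mulVec]
  rw [add_mulVec, dotProduct_add, hdiag, sub_dotProduct, add_dotProduct, smul_dotProduct, hE,
    smul_eq_mul]
  ring

/-- Lagrangian sufficiency underlying Theorem 2: if `A_r(λ̄,μ̄)` is positive
definite, `A_r(λ̄,μ̄) Ȳ = b_r(λ̄,μ̄)`, `E_r Ȳ = e` and `Ȳ ∘ Ȳ = Ȳ`, then `Ȳ` is a global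
solution of the constrained problem: `f(Ȳ) ≤ f(Y)` for every feasible `Y`. -/
theorem lagrangian_sufficiency (N m : ℕ) (hN : 0 < N) (hm : 0 < m)
    (A : Matrix (Fin N) (Fin N) ℝ) (hA : A.IsSymm)
    (b : Fin N → ℝ) (E : Matrix (Fin m) (Fin N) ℝ)
    (e : Fin m → ℝ) (he : e = fun _ => 1)
    (f : (Fin N → ℝ) → ℝ)
    (hf : ∀ Y, f Y = (1/2) * (Y ⬝ᵥ (A *ᵥ Y)) - b ⬝ᵥ Y)
    (Alm : (Fin m → ℝ) → (Fin N → ℝ) → Matrix (Fin N) (Fin N) ℝ)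
    (hAlm : ∀ lam mu, Alm lam mu = A + Matrix.diagonal mu)
    (blm : (Fin m → ℝ) → (Fin N → ℝ) → (Fin N → ℝ))
    (hblm : ∀ lam mu, blm lam mu = b + (1/2 : ℝ) • mu - Eᵀ *ᵥ lam)
    (lamBar : Fin m → ℝ) (muBar : Fin N → ℝ) (Ybar : Fin N → ℝ)
    (hpos : (Alm lamBar muBar).PosDef)
    (hstat : Alm lamBar muBar *ᵥ Ybar = blm lamBar muBar)
    (hfeas1 : E *ᵥ Ybar = e) (hfeas2 : Ybar * Ybar = Ybar) :
    ∀ Y : Fin N → ℝ, E *ᵥ Y = e → Y * Y = Y → f Ybar ≤ f Y := by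
  intro Y hEY hY
  rw [hAlm] at hpos hstat
  rw [hblm] at hstat
  rw [hf, hf, quadratic_eq_lagrangian_of_mul_self A b E lamBar muBar hfeas2,
    quadratic_eq_lagrangian_of_mul_self A b E lamBar muBar hY, hfeas1, hEY]
  exact sub_le_sub_right (quadratic_le_of_posSemidef hpos.posSemidef hstat Y) _
end

section
/- Zero duality gap at a multiplier pair with a feasible Lagrangian minimizer: if A_r(λ̄,μ̄) is positive definite, A_r(λ̄,μ̄) Ȳ = b_r(λ̄,μ̄), E_r Ȳ = e, and Ȳ ∘ Ȳ = Ȳ, then g(λ̄,μ̄) = f(Ȳ). -/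
open Matrix

/-- Zero duality gap at a multiplier pair with a feasible Lagrangian minimizer:
if `A_r(λ̄,μ̄)` is positive definite, `A_r(λ̄,μ̄) Ȳ = b_r(λ̄,μ̄)`, `E_r Ȳ = e` and
`Ȳ ∘ Ȳ = Ȳ`, then `g(λ̄,μ̄) = f(Ȳ)`. -/
theorem zero_duality_gap (N m : ℕ) (hN : 0 < N) (hm : 0 < m)
    (A : Matrix (Fin N) (Fin N) ℝ) (hA : A.IsSymm)
    (b : Fin N → ℝ) (E : Matrix (Fin m) (Fin N) ℝ)
    (e : Fin m → ℝ) (he : e = fun _ => 1)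
    (f : (Fin N → ℝ) → ℝ)
    (hf : ∀ Y, f Y = (1/2) * (Y ⬝ᵥ (A *ᵥ Y)) - b ⬝ᵥ Y)
    (Alm : (Fin m → ℝ) → (Fin N → ℝ) → Matrix (Fin N) (Fin N) ℝ)
    (hAlm : ∀ lam mu, Alm lam mu = A + Matrix.diagonal mu)
    (blm : (Fin m → ℝ) → (Fin N → ℝ) → (Fin N → ℝ))
    (hblm : ∀ lam mu, blm lam mu = b + (1/2 : ℝ) • mu - Eᵀ *ᵥ lam)
    (g : (Fin m → ℝ) → (Fin N → ℝ) → ℝ)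
    (hg : ∀ lam mu, g lam mu
      = -(1/2) * (blm lam mu ⬝ᵥ ((Alm lam mu)⁻¹ *ᵥ blm lam mu)) - lam ⬝ᵥ e)
    (lamBar : Fin m → ℝ) (muBar : Fin N → ℝ) (Ybar : Fin N → ℝ)
    (hpos : (Alm lamBar muBar).PosDef)
    (hstat : Alm lamBar muBar *ᵥ Ybar = blm lamBar muBar)
    (hfeas1 : E *ᵥ Ybar = e) (hfeas2 : Ybar * Ybar = Ybar) :
    g lamBar muBar = f Ybar := by
  have hinv : (Alm lamBar muBar)⁻¹ *ᵥ blm lamBar muBar = Ybar := by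
    rw [← hstat, mulVec_mulVec, nonsing_inv_mul _ ((isUnit_iff_isUnit_det _).mp hpos.isUnit),
      one_mulVec]
  have hdiag : Ybar ⬝ᵥ (diagonal muBar *ᵥ Ybar) = muBar ⬝ᵥ Ybar := by
    refine Finset.sum_congr rfl fun i _ => ?_
    have hi : Ybar i * Ybar i = Ybar i := congrFun hfeas2 i
    rw [mulVec_diagonal]
    linear_combination muBar i * hi
  have hquad : blm lamBar muBar ⬝ᵥ Ybar = Ybar ⬝ᵥ (A *ᵥ Ybar) + muBar ⬝ᵥ Ybar := by
    rw [← hstat, dotProduct_comm, hAlm, add_mulVec, dotProduct_add, hdiag]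
  have hlin : blm lamBar muBar ⬝ᵥ Ybar
      = b ⬝ᵥ Ybar + (1/2) * (muBar ⬝ᵥ Ybar) - lamBar ⬝ᵥ e := by
    rw [hblm, sub_dotProduct, add_dotProduct, smul_dotProduct, smul_eq_mul, mulVec_transpose,
      ← dotProduct_mulVec, hfeas1]
  rw [hg, hf, hinv]
  linear_combination (1/2) * hquad - hlin
end

section
/- Differentiability and gradient of the dual function: if (λ,μ) ∈ S⁺, i.e. A_r(λ,μ) is positive definite, then g is Fréchet differentiable at (λ,μ) and its derivative is the linear map (h,k) ↦ hᵀ(E_r Ȳ − e) + (1/2) kᵀ(Ȳ ∘ Ȳ − Ȳ), where Ȳ = A_r(λ,μ)⁻¹ b_r(λ,μ). -/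
open Matrix

open Matrix.Norms.Operator in
/-- The quadratic form `vᵀ M⁻¹ v`, with `M` symmetric and invertible at `x`, has derivative
`z ↦ 2 (v' z)ᵀ y - yᵀ (M' z) y` at `x`, where `y = M⁻¹ v`. -/
theorem Matrix.hasFDerivAt_dotProduct_inv_mulVec {V n : Type*} [NormedAddCommGroup V]
    [NormedSpace ℝ V] [Fintype n] [DecidableEq n] {M : V → Matrix n n ℝ}
    {M' : V →L[ℝ] Matrix n n ℝ} {v : V → n → ℝ} {v' : V →L[ℝ] n → ℝ} {x : V}
    (hM : HasFDerivAt M M' x) (hv : HasFDerivAt v v' x) (hsymm : (M x).IsSymm)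
    (hunit : IsUnit (M x)) :
    ∃ q' : V →L[ℝ] ℝ, HasFDerivAt (fun p => v p ⬝ᵥ ((M p)⁻¹ *ᵥ v p)) q' x ∧
      ∀ z, q' z = 2 * (v' z ⬝ᵥ ((M x)⁻¹ *ᵥ v x)) -
        ((M x)⁻¹ *ᵥ v x) ⬝ᵥ (M' z *ᵥ ((M x)⁻¹ *ᵥ v x)) := by
  obtain ⟨u, hu⟩ := hunit
  have huinv : (↑u⁻¹ : Matrix n n ℝ) = (M x)⁻¹ := by rw [← hu, coe_units_inv]
  have hinv : HasFDerivAt (fun p => (M p)⁻¹)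
      ((-ContinuousLinearMap.mulLeftRight ℝ _ (↑u⁻¹ : Matrix n n ℝ) ↑u⁻¹).comp M') x := by
    simp only [nonsing_inv_eq_ringInverse]
    exact (hu ▸ hasFDerivAt_ringInverse (𝕜 := ℝ) u).comp x hM
  have hmul := (mulVecBilin ℝ ℝ : Matrix n n ℝ →ₗ[ℝ] (n → ℝ) →ₗ[ℝ]
    (n → ℝ)).toContinuousBilinearMap.hasFDerivAt_of_bilinear hinv hv
  have hdot := (dotProductBilin ℝ ℝ : (n → ℝ) →ₗ[ℝ] (n → ℝ) →ₗ[ℝ]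
    ℝ).toContinuousBilinearMap.hasFDerivAt_of_bilinear hv hmul
  refine ⟨_, hdot, fun z => ?_⟩
  have hmove (w : n → ℝ) : v x ⬝ᵥ ((M x)⁻¹ *ᵥ w) = ((M x)⁻¹ *ᵥ v x) ⬝ᵥ w := by
    rw [dotProduct_mulVec, ← mulVec_transpose, transpose_nonsing_inv, hsymm.eq]
  change v x ⬝ᵥ ((M x)⁻¹ *ᵥ v' z +
    (-((↑u⁻¹ : Matrix n n ℝ) * M' z * (↑u⁻¹ : Matrix n n ℝ))) *ᵥ v x) +
    v' z ⬝ᵥ ((M x)⁻¹ *ᵥ v x) = _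
  rw [huinv, dotProduct_add, neg_mulVec, dotProduct_neg, ← mulVec_mulVec, ← mulVec_mulVec,
    hmove, hmove, dotProduct_comm (v' z)]
  ring

/-- Differentiability and gradient of the dual function: if `(λ,μ) ∈ S⁺`, i.e.
`A_r(λ,μ)` is positive definite, then `g` is Fréchet differentiable at `(λ,μ)` and its
derivative is the linear map `(h,k) ↦ hᵀ(E_r Ȳ − e) + (1/2) kᵀ(Ȳ ∘ Ȳ − Ȳ)`, where
`Ȳ = A_r(λ,μ)⁻¹ b_r(λ,μ)`. -/
theorem dual_fderiv (N m : ℕ) (hN : 0 < N) (hm : 0 < m)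
    (A : Matrix (Fin N) (Fin N) ℝ) (hA : A.IsSymm)
    (b : Fin N → ℝ) (E : Matrix (Fin m) (Fin N) ℝ)
    (e : Fin m → ℝ) (he : e = fun _ => 1)
    (Alm : (Fin m → ℝ) → (Fin N → ℝ) → Matrix (Fin N) (Fin N) ℝ)
    (hAlm : ∀ lam mu, Alm lam mu = A + Matrix.diagonal mu)
    (blm : (Fin m → ℝ) → (Fin N → ℝ) → (Fin N → ℝ))
    (hblm : ∀ lam mu, blm lam mu = b + (1/2 : ℝ) • mu - Eᵀ *ᵥ lam)
    (g : (Fin m → ℝ) × (Fin N → ℝ) → ℝ)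
    (hg : ∀ p : (Fin m → ℝ) × (Fin N → ℝ), g p
      = -(1/2) * (blm p.1 p.2 ⬝ᵥ ((Alm p.1 p.2)⁻¹ *ᵥ blm p.1 p.2)) - p.1 ⬝ᵥ e)
    (lam : Fin m → ℝ) (mu : Fin N → ℝ) (hpos : (Alm lam mu).PosDef)
    (Ybar : Fin N → ℝ) (hYbar : Ybar = (Alm lam mu)⁻¹ *ᵥ blm lam mu) :
    DifferentiableAt ℝ g (lam, mu) ∧
      ∀ (h : Fin m → ℝ) (k : Fin N → ℝ),
        fderiv ℝ g (lam, mu) (h, k)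
          = h ⬝ᵥ (E *ᵥ Ybar - e) + (1/2) * (k ⬝ᵥ (Ybar * Ybar - Ybar)) := by
  have hfst : HasFDerivAt (fun p : (Fin m → ℝ) × (Fin N → ℝ) => p.1)
      (ContinuousLinearMap.fst ℝ _ _) (lam, mu) := hasFDerivAt_fst
  have hsnd : HasFDerivAt (fun p : (Fin m → ℝ) × (Fin N → ℝ) => p.2)
      (ContinuousLinearMap.snd ℝ _ _) (lam, mu) := hasFDerivAt_snd
  open Matrix.Norms.Operator in
  have hM := (((diagonalLinearMap (Fin N) ℝ ℝ).toContinuousLinearMap.hasFDerivAt).comp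
    (lam, mu) hsnd).const_add A
  have hv := ((hsnd.const_smul (1 / 2 : ℝ)).const_add b).sub
    ((Eᵀ.mulVecLin.toContinuousLinearMap.hasFDerivAt).comp (lam, mu) hfst)
  have hlin := (((dotProductBilin ℝ ℝ : (Fin m → ℝ) →ₗ[ℝ] (Fin m → ℝ) →ₗ[ℝ]
    ℝ).flip e).toContinuousLinearMap.hasFDerivAt).comp (lam, mu) hfst
  rw [hAlm] at hpos
  obtain ⟨q', hq, hq'⟩ := hasFDerivAt_dotProduct_inv_mulVec hM hv
    (hA.add (isSymm_diagonal mu)) hpos.isUnit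
  have hderiv := (hq.const_mul (-(1 / 2))).sub hlin
  have hg_deriv : HasFDerivAt g _ (lam, mu) :=
    hderiv.congr_of_eventuallyEq (.of_forall fun p => by rw [hg, hAlm, hblm]; rfl)
  refine ⟨hg_deriv.differentiableAt, fun h k => ?_⟩
  rw [hg_deriv.fderiv]
  change -(1 / 2) * q' (h, k) - h ⬝ᵥ e = _
  rw [hq' (h, k)]
  change -(1 / 2) * (2 * (((1 / 2 : ℝ) • k - Eᵀ *ᵥ h) ⬝ᵥ
    ((A + diagonal mu)⁻¹ *ᵥ (b + (1 / 2 : ℝ) • mu - Eᵀ *ᵥ lam))) -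
    ((A + diagonal mu)⁻¹ *ᵥ (b + (1 / 2 : ℝ) • mu - Eᵀ *ᵥ lam)) ⬝ᵥ (diagonal k *ᵥ
      ((A + diagonal mu)⁻¹ *ᵥ (b + (1 / 2 : ℝ) • mu - Eᵀ *ᵥ lam)))) - h ⬝ᵥ e = _
  rw [← hblm, ← hAlm lam mu, ← hYbar]
  have hdiag : Ybar ⬝ᵥ (diagonal k *ᵥ Ybar) = k ⬝ᵥ (Ybar * Ybar) := by
    simp only [dotProduct, mulVec_diagonal, Pi.mul_apply]
    exact Finset.sum_congr rfl fun i _ => by ring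
  rw [hdiag, sub_dotProduct, smul_dotProduct, mulVec_transpose, ← dotProduct_mulVec,
    dotProduct_sub, dotProduct_sub, smul_eq_mul]
  ring
end

section
/- (Theorem 2.) If (λ̄,μ̄) ∈ S⁺, i.e. A_r(λ̄,μ̄) is positive definite, and (λ̄,μ̄) is a critical point of the dual function g (the Fréchet derivative of g at (λ̄,μ̄) is the zero linear map), then Ȳ = A_r(λ̄,μ̄)⁻¹ b_r(λ̄,μ̄) is a global solution of the primal problem: Ȳ is feasible (E_r Ȳ = e and Ȳ ∘ Ȳ = Ȳ) and f(Ȳ) ≤ f(Y) for every feasible Y. -/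
open Matrix

namespace Matrix

variable {n m : Type*} [Fintype n] [Fintype m]

/-- Completing the square for a symmetric quadratic form around the point `y`. -/
lemma IsSymm.quadratic_sub_linear {M : Matrix n n ℝ} (hM : M.IsSymm) (y Y : n → ℝ) :
    (1 / 2) * (Y ⬝ᵥ (M *ᵥ Y)) - (M *ᵥ y) ⬝ᵥ Y =
      (1 / 2) * ((Y - y) ⬝ᵥ (M *ᵥ (Y - y))) - (1 / 2) * ((M *ᵥ y) ⬝ᵥ y) := by
  have h : y ⬝ᵥ (M *ᵥ Y) = Y ⬝ᵥ (M *ᵥ y) := by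
    rw [dotProduct_mulVec, ← mulVec_transpose, hM.eq, dotProduct_comm]
  simp only [mulVec_sub, dotProduct_sub, sub_dotProduct]
  rw [h, dotProduct_comm (M *ᵥ y) Y, dotProduct_comm (M *ᵥ y) y]
  ring

/-- The Lagrangian of the binary quadratic program, as an affine function of the multipliers. -/
lemma binary_lagrangian_eq [DecidableEq n] (A : Matrix n n ℝ) (b : n → ℝ) (E : Matrix m n ℝ)
    (e lam : m → ℝ) (mu Y : n → ℝ) :
    (1 / 2) * (Y ⬝ᵥ ((A + diagonal mu) *ᵥ Y)) - (b + (1 / 2 : ℝ) • mu - Eᵀ *ᵥ lam) ⬝ᵥ Y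
        - lam ⬝ᵥ e =
      (1 / 2) * (Y ⬝ᵥ (A *ᵥ Y)) - b ⬝ᵥ Y
        + (lam ⬝ᵥ (E *ᵥ Y - e) + mu ⬝ᵥ ((1 / 2 : ℝ) • (Y * Y - Y))) := by
  have h1 : (Eᵀ *ᵥ lam) ⬝ᵥ Y = lam ⬝ᵥ (E *ᵥ Y) := by
    rw [mulVec_transpose, dotProduct_mulVec]
  have h2 : Y ⬝ᵥ (diagonal mu *ᵥ Y) = mu ⬝ᵥ (Y * Y) := by
    simp only [dotProduct, mulVec_diagonal, Pi.mul_apply]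
    exact Finset.sum_congr rfl fun i _ => by ring
  simp only [add_mulVec, dotProduct_add, add_dotProduct, sub_dotProduct, dotProduct_sub,
    smul_dotProduct, dotProduct_smul, smul_eq_mul, h1, h2]
  ring

variable {V : Type*} [NormedAddCommGroup V] [NormedSpace ℝ V]

attribute [local instance] Matrix.linftyOpNormedRing Matrix.linftyOpNormedAlgebra in
/-- The solution `(M x)⁻¹ c x` of a linear system depends differentiably on its entries. -/
lemma differentiableAt_inv_mulVec [DecidableEq n] {M : V → Matrix n n ℝ} {c : V → n → ℝ} {x : V}
    (hM : ∀ i j, DifferentiableAt ℝ (fun p => M p i j) x) (hc : DifferentiableAt ℝ c x)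
    (hx : IsUnit (M x)) : DifferentiableAt ℝ (fun p => (M p)⁻¹ *ᵥ c p) x := by
  have hM' : DifferentiableAt ℝ M x := by
    have : M = fun p => ∑ i, ∑ j, M p i j • Matrix.single i j (1 : ℝ) := by
      funext p
      conv_lhs => rw [matrix_eq_sum_single (M p)]
      simp
    rw [this]
    refine DifferentiableAt.fun_sum fun i _ => DifferentiableAt.fun_sum fun j _ => ?_
    exact (hM i j).smul_const _
  have hinv : DifferentiableAt ℝ (fun p => (M p)⁻¹) x := by
    simp only [nonsing_inv_eq_ringInverse]
    exact hM'.inverse hx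
  have hentry (i j : n) : DifferentiableAt ℝ (fun p => (M p)⁻¹ i j) x :=
    (LinearMap.toContinuousLinearMap
      (Matrix.entryLinearMap ℝ ℝ i j : Matrix n n ℝ →ₗ[ℝ] ℝ)).differentiableAt.comp x hinv
  rw [differentiableAt_pi] at hc ⊢
  intro i
  simp only [mulVec, dotProduct]
  exact DifferentiableAt.fun_sum fun j _ => (hentry i j).mul (hc j)

/-- A quadratic form evaluated at a vector vanishing at `x` has zero derivative at `x`. -/
lemma hasFDerivAt_quadratic_zero {M : V → Matrix n n ℝ} {d : V → n → ℝ} {x : V}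
    (hM : ∀ i j, DifferentiableAt ℝ (fun p => M p i j) x) (hd : DifferentiableAt ℝ d x)
    (hx : d x = 0) : HasFDerivAt (fun p => d p ⬝ᵥ (M p *ᵥ d p)) (0 : V →L[ℝ] ℝ) x := by
  rw [differentiableAt_pi] at hd
  have key (i j : n) :
      HasFDerivAt (fun p => d p i * (M p i j * d p j)) (0 : V →L[ℝ] ℝ) x := by
    have h := (hd i).hasFDerivAt.mul ((hM i j).mul (hd j)).hasFDerivAt
    simpa [hx, Pi.mul_def] using h
  have h := HasFDerivAt.fun_sum (u := Finset.univ) fun i _ =>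
    HasFDerivAt.fun_sum (u := Finset.univ) fun j _ => key i j
  simpa only [dotProduct, mulVec, Finset.mul_sum, Finset.sum_const_zero] using h

end Matrix

/-- Theorem 2: If `(λ̄,μ̄) ∈ S⁺`, i.e. `A_r(λ̄,μ̄)` is positive definite, and
`(λ̄,μ̄)` is a critical point of the dual function `g`, then `Ȳ = A_r(λ̄,μ̄)⁻¹ b_r(λ̄,μ̄)` is
a global solution of the primal problem: `Ȳ` is feasible and `f(Ȳ) ≤ f(Y)` for every
feasible `Y`. -/
theorem dual_critical_point_gives_global_solution (N m : ℕ) (hN : 0 < N) (hm : 0 < m)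
    (A : Matrix (Fin N) (Fin N) ℝ) (hA : A.IsSymm)
    (b : Fin N → ℝ) (E : Matrix (Fin m) (Fin N) ℝ)
    (e : Fin m → ℝ) (he : e = fun _ => 1)
    (f : (Fin N → ℝ) → ℝ)
    (hf : ∀ Y, f Y = (1/2) * (Y ⬝ᵥ (A *ᵥ Y)) - b ⬝ᵥ Y)
    (Alm : (Fin m → ℝ) → (Fin N → ℝ) → Matrix (Fin N) (Fin N) ℝ)
    (hAlm : ∀ lam mu, Alm lam mu = A + Matrix.diagonal mu)
    (blm : (Fin m → ℝ) → (Fin N → ℝ) → (Fin N → ℝ))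
    (hblm : ∀ lam mu, blm lam mu = b + (1/2 : ℝ) • mu - Eᵀ *ᵥ lam)
    (g : (Fin m → ℝ) × (Fin N → ℝ) → ℝ)
    (hg : ∀ p : (Fin m → ℝ) × (Fin N → ℝ), g p
      = -(1/2) * (blm p.1 p.2 ⬝ᵥ ((Alm p.1 p.2)⁻¹ *ᵥ blm p.1 p.2)) - p.1 ⬝ᵥ e)
    (lamBar : Fin m → ℝ) (muBar : Fin N → ℝ)
    (hpos : (Alm lamBar muBar).PosDef)
    (hcrit : fderiv ℝ g (lamBar, muBar) = 0)
    (Ybar : Fin N → ℝ) (hYbar : Ybar = (Alm lamBar muBar)⁻¹ *ᵥ blm lamBar muBar) :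
    (E *ᵥ Ybar = e ∧ Ybar * Ybar = Ybar) ∧
      ∀ Y : Fin N → ℝ, E *ᵥ Y = e → Y * Y = Y → f Ybar ≤ f Y := by
  have hsymm (mu : Fin N → ℝ) : (A + diagonal mu).IsSymm := hA.add (isSymm_diagonal mu)
  set x : (Fin m → ℝ) × (Fin N → ℝ) := (lamBar, muBar) with hx
  have hentry (i j : Fin N) : DifferentiableAt ℝ
      (fun p : (Fin m → ℝ) × (Fin N → ℝ) => Alm p.1 p.2 i j) x := by
    simp only [hAlm, Matrix.add_apply, diagonal_apply]
    split_ifs <;> fun_prop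
  have hb : DifferentiableAt ℝ (fun p : (Fin m → ℝ) × (Fin N → ℝ) => blm p.1 p.2) x := by
    simp only [hblm]
    have hE : DifferentiableAt ℝ (fun p : (Fin m → ℝ) × (Fin N → ℝ) => Eᵀ *ᵥ p.1) x :=
      (LinearMap.toContinuousLinearMap Eᵀ.mulVecLin).differentiableAt.comp x
        differentiableAt_fst
    fun_prop
  have hy := differentiableAt_inv_mulVec hentry hb hpos.isUnit
  have hunit : ∀ᶠ p : (Fin m → ℝ) × (Fin N → ℝ) in nhds x, IsUnit (Alm p.1 p.2).det := by
    have hdet : Continuous fun p : (Fin m → ℝ) × (Fin N → ℝ) => (Alm p.1 p.2).det := by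
      simp only [hAlm]
      fun_prop
    filter_upwards [hdet.continuousAt.eventually_ne hpos.det_pos.ne'] with p hp
    exact isUnit_iff_ne_zero.mpr hp
  let L : (Fin m → ℝ) × (Fin N → ℝ) →ₗ[ℝ] ℝ :=
    { toFun := fun p => p.1 ⬝ᵥ (E *ᵥ Ybar - e) + p.2 ⬝ᵥ ((1 / 2 : ℝ) • (Ybar * Ybar - Ybar))
      map_add' := fun p q => by simp only [Prod.fst_add, Prod.snd_add, add_dotProduct]; ring
      map_smul' := fun c p => by
        simp only [Prod.smul_fst, Prod.smul_snd, smul_dotProduct, smul_eq_mul, RingHom.id_apply]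
        ring }
  have hsq : HasFDerivAt (fun p : (Fin m → ℝ) × (Fin N → ℝ) =>
      (Ybar - (Alm p.1 p.2)⁻¹ *ᵥ blm p.1 p.2) ⬝ᵥ
        (Alm p.1 p.2 *ᵥ (Ybar - (Alm p.1 p.2)⁻¹ *ᵥ blm p.1 p.2)))
      (0 : (Fin m → ℝ) × (Fin N → ℝ) →L[ℝ] ℝ) x :=
    hasFDerivAt_quadratic_zero hentry (hy.const_sub Ybar) (by simp [hx, hYbar])
  have hgL : HasFDerivAt g (LinearMap.toContinuousLinearMap L) x := by
    have h := ((LinearMap.toContinuousLinearMap L).hasFDerivAt (x := x)).const_add (f Ybar)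
      |>.sub (hsq.const_mul (1 / 2))
    rw [smul_zero, sub_zero] at h
    refine h.congr_of_eventuallyEq ?_
    filter_upwards [hunit] with p hp
    have hsolve : Alm p.1 p.2 *ᵥ ((Alm p.1 p.2)⁻¹ *ᵥ blm p.1 p.2) = blm p.1 p.2 := by
      rw [mulVec_mulVec, mul_nonsing_inv _ hp, one_mulVec]
    have h1 := (hsymm p.2).quadratic_sub_linear ((Alm p.1 p.2)⁻¹ *ᵥ blm p.1 p.2) Ybar
    have h2 := binary_lagrangian_eq A b E e p.1 p.2 Ybar
    rw [← hAlm p.1, hsolve] at h1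
    rw [← hAlm p.1, ← hblm] at h2
    have hL : LinearMap.toContinuousLinearMap L p = p.1 ⬝ᵥ (E *ᵥ Ybar - e) +
      p.2 ⬝ᵥ ((1 / 2 : ℝ) • (Ybar * Ybar - Ybar)) := rfl
    simp only [Pi.sub_apply, hL, hg, hf]
    linarith
  have hL0 (p : (Fin m → ℝ) × (Fin N → ℝ)) : p.1 ⬝ᵥ (E *ᵥ Ybar - e) +
      p.2 ⬝ᵥ ((1 / 2 : ℝ) • (Ybar * Ybar - Ybar)) = 0 :=
    DFunLike.congr_fun (hgL.fderiv.symm.trans hcrit) p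
  have hE : E *ᵥ Ybar = e := by
    refine sub_eq_zero.mp (dotProduct_self_eq_zero.mp ?_)
    simpa using hL0 (E *ᵥ Ybar - e, 0)
  have hbin : Ybar * Ybar = Ybar := by
    refine sub_eq_zero.mp (dotProduct_self_eq_zero.mp ?_)
    simpa using hL0 (0, Ybar * Ybar - Ybar)
  refine ⟨⟨hE, hbin⟩, fun Y hEY hY => ?_⟩
  have hsolve : Alm lamBar muBar *ᵥ Ybar = blm lamBar muBar := by
    rw [hYbar, mulVec_mulVec, mul_nonsing_inv _ hunit.self_of_nhds, one_mulVec]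
  have h1 := (hsymm muBar).quadratic_sub_linear Ybar Y
  have h2 := binary_lagrangian_eq A b E e lamBar muBar Ybar
  have h3 := binary_lagrangian_eq A b E e lamBar muBar Y
  rw [← hAlm lamBar, hsolve] at h1
  rw [← hAlm lamBar, ← hblm] at h2 h3
  rw [hsolve, dotProduct_comm Ybar] at h2
  have hnonneg := hpos.posSemidef.dotProduct_mulVec_nonneg (Y - Ybar)
  simp only [star_trivial] at hnonneg
  simp only [hE, hbin, hEY, hY, sub_self, smul_zero, dotProduct_zero,
    add_zero] at h2 h3
  rw [hf, hf]
  linarith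
end
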